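/- arXiv:1210.2840 — 2 statements merged into one kernel-verified Lean document; each statement's English description precedes it below -/
import Mathlib

section
/- Let k be a field, A an associative k-algebra, and C ⊆ A a k-subalgebra. For φ ∈ IQ^p(A,C) and a k-multilinear map ξ : C^q → A, define ℓ_φ(ξ) : C^{p+q−1} → A by (ℓ_φ ξ)(c_1,...,c_{p+q−1}) = Σ_{l=0}^{p−1} (−1)^{l(q−1)} φ(c_1,...,c_l, ξ(c_{l+1},...,c_{l+q}), c_{l+q+1},...,c_{p+q−1}). Then ℓ defines a graded Lie algebra action of IQ^*(A,C) on the space of k-multilinear maps from powers of C to A: for all φ ∈ IQ^p(A,C), φ' ∈ IQ^{p'}(A,C), and all k-multilinear ξ : C^q → A, ℓ_{[φ,φ']}(ξ) = ℓ_φ(ℓ_{φ'}(ξ)) − (−1)^{(p−1)(p'−1)} ℓ_{φ'}(ℓ_φ(ξ)). -/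
/-- The Hochschild differential of a `k`-multilinear cochain `φ ∈ CHⁿ(A)`, evaluated on the
tuple `(f 0, …, f n)` (so on `n+1` arguments):
`dφ(f₁,…,f_{n+1}) = f₁·φ(f₂,…,f_{n+1}) + Σ_{j=1}^{n} (−1)ʲ φ(f₁,…,f_j·f_{j+1},…,f_{n+1})
 + (−1)^{n+1} φ(f₁,…,f_n)·f_{n+1}`. -/
noncomputable def hochD {k A : Type*} [Field k] [Ring A] [Algebra k A] {n : ℕ}
    (φ : MultilinearMap k (fun _ : Fin n => A) A) (f : ℕ → A) : A :=
  f 0 * φ (fun i => f ((i : ℕ) + 1))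
    + ∑ j ∈ Finset.range n, ((-1 : ℤ) ^ (j + 1)) •
        φ (fun i => if (i : ℕ) < j then f i
            else if (i : ℕ) = j then f j * f (j + 1) else f ((i : ℕ) + 1))
    + ((-1 : ℤ) ^ (n + 1)) • (φ (fun i => f (i : ℕ)) * f n)

/-- The Gerstenhaber composition `φ∘ψ` of `φ ∈ CHᵖ(A)` and `ψ ∈ CH^q(A)`, evaluated on the
tuple `(f 0, …, f (p+q-2))`:
`(φ∘ψ)(f₁,…,f_{p+q−1}) = Σ_{l=0}^{p−1} (−1)^{l(q−1)}
  φ(f₁,…,f_l, ψ(f_{l+1},…,f_{l+q}), f_{l+q+1},…,f_{p+q−1})`. -/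
noncomputable def gComp {k A : Type*} [Field k] [Ring A] [Algebra k A] {p q : ℕ}
    (φ : MultilinearMap k (fun _ : Fin p => A) A)
    (ψ : MultilinearMap k (fun _ : Fin q => A) A) (f : ℕ → A) : A :=
  ∑ l ∈ Finset.range p, ((-1 : ℤ) ^ (l * (q - 1))) •
    φ (fun i => if (i : ℕ) < l then f i
        else if (i : ℕ) = l then ψ (fun m => f (l + (m : ℕ))) else f ((i : ℕ) + q - 1))

/-- The operation `ℓ_φ(ξ)` of `φ ∈ IQᵖ(A,C)` (given here as a raw cochain of arity `p`) on a
cochain `ξ` of arity `q` on `C` with values in `A`, evaluated on the tuple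
`(c 0, …, c (p+q-2))` of elements of `C`:
`(ℓ_φ ξ)(c₁,…,c_{p+q−1}) = Σ_{l=0}^{p−1} (−1)^{l(q−1)}
  φ(c₁,…,c_l, ξ(c_{l+1},…,c_{l+q}), c_{l+q+1},…,c_{p+q−1})`. -/
noncomputable def ellAct {k A : Type*} [Field k] [Ring A] [Algebra k A] {C : Subalgebra k A}
    (p q : ℕ) (φ : (ℕ → A) → A) (ξ : (ℕ → C) → A) (c : ℕ → C) : A :=
  ∑ l ∈ Finset.range p, ((-1 : ℤ) ^ (l * (q - 1))) •
    φ (fun i => if i < l then (c i : A)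
        else if i = l then ξ (fun m => c (l + m)) else (c (i + q - 1) : A))

/-- A multilinear map applied to a tuple with a distinguished entry `x` at position `l` is
linear in `x`. -/
theorem MultilinearMap.apply_ite_eq_toLinearMap {k A : Type*} [Field k] [Ring A] [Algebra k A]
    {p : ℕ} (φ : MultilinearMap k (fun _ : Fin p => A) A) {l : ℕ} (hl : l < p)
    (a b : ℕ → A) (x : A) :
    φ (fun i => if (i : ℕ) < l then a i else if (i : ℕ) = l then x else b i)
      = φ.toLinearMap (fun i => if (i : ℕ) < l then a i else b i) ⟨l, hl⟩ x := by
  rw [MultilinearMap.toLinearMap_apply]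
  congr 1
  funext i
  by_cases h : (i : ℕ) = l
  · obtain rfl : i = ⟨l, hl⟩ := Fin.ext h
    simp
  · rw [Function.update_of_ne (fun e => h (congrArg Fin.val e))]
    simp [h]

/-- If `φ'` vanishes on tuples of elements of `C`, then `ℓ` sends the Gerstenhaber composition
`φ∘φ'` to the composite of `ℓ_φ` and `ℓ_φ'`. -/
theorem ellAct_gComp {k A : Type*} [Field k] [Ring A] [Algebra k A]
    (C : Subalgebra k A) (p p' q : ℕ) (hp' : 1 ≤ p') (hq : 1 ≤ q)
    (φ : MultilinearMap k (fun _ : Fin p => A) A)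
    (φ' : MultilinearMap k (fun _ : Fin p' => A) A)
    (hφ' : ∀ c : Fin p' → A, (∀ i, c i ∈ C) → φ' c = 0)
    (ξ : (ℕ → C) → A) (c : ℕ → C) :
    ellAct (C := C) (p + p' - 1) q (fun f => gComp φ φ' f) ξ c
      = ellAct (C := C) p (p' + q - 1) (fun f => φ (fun i : Fin p => f (i : ℕ)))
          (ellAct (C := C) p' q (fun f => φ' (fun i : Fin p' => f (i : ℕ))) ξ) c := by
  simp only [ellAct, gComp, Finset.smul_sum]
  rw [Finset.sum_comm]
  refine Finset.sum_congr rfl fun j hj => ?_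
  have hjp : j < p := Finset.mem_range.mp hj
  rw [φ.apply_ite_eq_toLinearMap hjp (fun i => (c i : A))
    (fun i => (c (i + (p' + q - 1) - 1) : A)), map_sum, Finset.smul_sum]
  have hsub : Finset.Ico j (j + p') ⊆ Finset.range (p + p' - 1) := by
    intro l hl
    simp only [Finset.mem_Ico, Finset.mem_range] at hl ⊢
    omega
  rw [← Finset.sum_subset hsub, Finset.sum_Ico_eq_sum_range, Nat.add_sub_cancel_left]
  · refine Finset.sum_congr rfl fun m hm => ?_
    have hmp : m < p' := Finset.mem_range.mp hm
    rw [map_zsmul, smul_smul, smul_smul]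
    congr 1
    · rw [← pow_add, ← pow_add]
      congr 1
      obtain ⟨r, rfl⟩ := Nat.exists_eq_add_of_le hp'
      obtain ⟨s, rfl⟩ := Nat.exists_eq_add_of_le hq
      rw [show 1 + r + (1 + s) - 1 - 1 = r + s by omega, Nat.add_sub_cancel_left,
        Nat.add_sub_cancel_left]
      ring
    · rw [← φ.apply_ite_eq_toLinearMap hjp (fun i => (c i : A))
        (fun i => (c (i + (p' + q - 1) - 1) : A))]
      congr 1
      funext i
      rcases lt_trichotomy (i : ℕ) j with h | h | h
      · simp [h, show (i : ℕ) < j + m by omega]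
      · simp only [h, lt_irrefl, if_false, if_true]
        congr 1
        funext n
        simp only [add_lt_add_iff_left, add_right_inj, add_assoc]
        rw [show j + ((n : ℕ) + q) - 1 = j + ((n : ℕ) + q - 1) by omega]
      · simp only [show ¬ (i : ℕ) < j by omega, show ¬ (i : ℕ) = j by omega,
          show ¬ (i : ℕ) + p' - 1 < j + m by omega, show ¬ (i : ℕ) + p' - 1 = j + m by omega,
          if_false]
        rw [show (i : ℕ) + p' - 1 + q - 1 = i + (p' + q - 1) - 1 by omega]
  · intro l _ hl
    rw [Finset.mem_Ico] at hl
    rw [φ.map_coord_zero ⟨j, hjp⟩, smul_zero, smul_zero]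
    simp only [lt_irrefl, if_false, if_true]
    refine hφ' _ fun m => ?_
    have hm := m.isLt
    rw [if_neg (show ¬ j + (m : ℕ) = l by omega)]
    split_ifs
    exacts [SetLike.coe_mem _, SetLike.coe_mem _]

/-- `ℓ` defines a graded Lie algebra action of `IQ^*(A,C)` on the
`k`-multilinear maps from powers of `C` to `A`:
`ℓ_{[φ,φ']}(ξ) = ℓ_φ(ℓ_{φ'}(ξ)) − (−1)^{(p−1)(p'−1)} ℓ_{φ'}(ℓ_φ(ξ))`. -/
theorem statement10 {k A : Type*} [Field k] [Ring A] [Algebra k A]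
    (C : Subalgebra k A) (p p' q : ℕ) (hp : 1 ≤ p) (hp' : 1 ≤ p') (hq : 1 ≤ q)
    (φ : MultilinearMap k (fun _ : Fin p => A) A)
    (φ' : MultilinearMap k (fun _ : Fin p' => A) A)
    (hφ : ∀ c : Fin p → A, (∀ i, c i ∈ C) → φ c = 0)
    (hφ' : ∀ c : Fin p' → A, (∀ i, c i ∈ C) → φ' c = 0)
    (ξ : MultilinearMap k (fun _ : Fin q => C) A) :
    ∀ c : ℕ → C,
      ellAct (C := C) (p + p' - 1) q
          (fun f => gComp φ φ' f - ((-1 : ℤ) ^ ((p - 1) * (p' - 1))) • gComp φ' φ f)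
          (fun c' => ξ (fun m : Fin q => c' (m : ℕ))) c
        = ellAct (C := C) p (p' + q - 1) (fun f => φ (fun i : Fin p => f (i : ℕ)))
            (ellAct (C := C) p' q (fun f => φ' (fun i : Fin p' => f (i : ℕ)))
              (fun c' => ξ (fun m : Fin q => c' (m : ℕ)))) c
          - ((-1 : ℤ) ^ ((p - 1) * (p' - 1))) •
            ellAct (C := C) p' (p + q - 1) (fun f => φ' (fun i : Fin p' => f (i : ℕ)))
              (ellAct (C := C) p q (fun f => φ (fun i : Fin p => f (i : ℕ)))
                (fun c' => ξ (fun m : Fin q => c' (m : ℕ)))) c := by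
  intro c
  rw [← ellAct_gComp C p p' q hp' hq φ φ' hφ', ← ellAct_gComp C p' p q hp hq φ' φ hφ,
    Nat.add_comm p' p]
  simp only [ellAct, smul_sub, Finset.sum_sub_distrib, Finset.smul_sum]
  congr 1
  exact Finset.sum_congr rfl fun l _ => smul_comm _ _ _
end

section
/- Let k be a field of characteristic zero, A a commutative k-algebra, and X_1, ..., X_n k-derivations of A. Define the Hochschild-Kostant-Rosenberg cochain χ ∈ CH^n(A) by χ(f_1,...,f_n) = (1/n!) Σ_{σ ∈ S_n} sgn(σ) X_1(f_{σ(1)})·X_2(f_{σ(2)})···X_n(f_{σ(n)}). Then χ is a Hochschild n-cocycle: dχ = 0, i.e. for all f_1, ..., f_{n+1} ∈ A, f_1·χ(f_2,...,f_{n+1}) + Σ_{j=1}^{n} (−1)^j χ(f_1,...,f_j·f_{j+1},...,f_{n+1}) + (−1)^{n+1} χ(f_1,...,f_n)·f_{n+1} = 0. -/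
/-- The antisymmetrized product of derivations is a derivation in each argument. -/
lemma sum_sign_prod_derivation_update_mul {k A : Type*} [CommRing k] [CommRing A] [Algebra k A]
    {ι : Type*} [Fintype ι] [DecidableEq ι] (X : ι → Derivation k A A)
    (c : ι → A) (j : ι) (a b : A) :
    ∑ σ : Equiv.Perm ι, (Equiv.Perm.sign σ : ℤ) •
        ∏ i, X i (Function.update c j (a * b) (σ i)) =
      a * ∑ σ : Equiv.Perm ι, (Equiv.Perm.sign σ : ℤ) •
        ∏ i, X i (Function.update c j b (σ i)) +
      b * ∑ σ : Equiv.Perm ι, (Equiv.Perm.sign σ : ℤ) •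
        ∏ i, X i (Function.update c j a (σ i)) := by
  rw [Finset.mul_sum, Finset.mul_sum, ← Finset.sum_add_distrib]
  refine Finset.sum_congr rfl fun σ _ => ?_
  have split (x : A) : ∏ i, X i (Function.update c j x (σ i)) =
      X (σ.symm j) x * ∏ i ∈ Finset.univ.erase (σ.symm j), X i (c (σ i)) := by
    rw [← Finset.mul_prod_erase _ _ (Finset.mem_univ (σ.symm j))]
    congr 1
    · simp
    · refine Finset.prod_congr rfl fun i hi => ?_
      have hij : σ i ≠ j := fun h => (Finset.mem_erase.mp hi).1 (by simp [← h])
      rw [Function.update_of_ne hij]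
  simp only [split, Derivation.leibniz, smul_eq_mul, zsmul_eq_mul]
  ring

lemma sum_range_neg_one_pow_smul_add_succ {M : Type*} [AddCommGroup M] (T : ℕ → M) (n : ℕ) :
    ∑ j ∈ Finset.range n, ((-1 : ℤ) ^ (j + 1)) • (T j + T (j + 1)) =
      -T 0 + ((-1 : ℤ) ^ n) • T n := by
  induction n with
  | zero => simp
  | succ n ih =>
    rw [Finset.sum_range_succ, ih, pow_succ]
    module


/-- for `k`-derivations `X₁, …, X_n` of a commutative `k`-algebra `A`
(char k = 0), the Hochschild–Kostant–Rosenberg cochain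
`χ(f₁,…,f_n) = (1/n!) Σ_{σ ∈ S_n} sgn(σ)·X₁(f_{σ(1)})⋯X_n(f_{σ(n)})`
is a Hochschild `n`-cocycle: `dχ = 0`. -/
theorem statement11 {k A : Type*} [Field k] [CharZero k] [CommRing A] [Algebra k A]
    (n : ℕ) (X : Fin n → Derivation k A A)
    (χ : (Fin n → A) → A)
    (hχ : ∀ c : Fin n → A, χ c = ((n.factorial : k))⁻¹ •
      ∑ σ : Equiv.Perm (Fin n), ((Equiv.Perm.sign σ : ℤ)) • ∏ i, X i (c (σ i))) :
    ∀ f : ℕ → A,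
      f 0 * χ (fun i => f ((i : ℕ) + 1))
        + ∑ j ∈ Finset.range n, ((-1 : ℤ) ^ (j + 1)) •
            χ (fun i => if (i : ℕ) < j then f i
                else if (i : ℕ) = j then f j * f (j + 1) else f ((i : ℕ) + 1))
        + ((-1 : ℤ) ^ (n + 1)) • (χ (fun i => f (i : ℕ)) * f n) = 0 := by
  intro f
  have leibniz (c : Fin n → A) (j : Fin n) (a b : A) :
      χ (Function.update c j (a * b)) =
        a * χ (Function.update c j b) + b * χ (Function.update c j a) := by
    simp only [hχ, sum_sign_prod_derivation_update_mul, smul_add, mul_smul_comm]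
  -- `T j` is `f j` times the value of `χ` on the remaining entries of `f`.
  let T : ℕ → A := fun j => f j * χ (fun i => if (i : ℕ) < j then f i else f ((i : ℕ) + 1))
  have face (j : ℕ) (hj : j ∈ Finset.range n) :
      χ (fun i => if (i : ℕ) < j then f i
        else if (i : ℕ) = j then f j * f (j + 1) else f ((i : ℕ) + 1)) = T j + T (j + 1) := by
    have hjn : j < n := Finset.mem_range.mp hj
    have key := leibniz (fun i => if (i : ℕ) < j then f i else f ((i : ℕ) + 1))
      ⟨j, hjn⟩ (f j) (f (j + 1))
    simp only [T]
    convert key using 5 <;>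
    · simp only [Function.update_apply, Fin.ext_iff]
      grind
  have first : f 0 * χ (fun i => f ((i : ℕ) + 1)) = T 0 := by simp [T]
  have last : χ (fun i => f (i : ℕ)) * f n = T n := by simp [T, mul_comm]
  rw [Finset.sum_congr rfl fun j hj => by rw [face j hj],
    sum_range_neg_one_pow_smul_add_succ, first, last, pow_succ]
  module
end
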